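/- arXiv:1701.01280 — 2 statements merged into one kernel-verified Lean document; each statement's English description precedes it below -/
import Mathlib

section
/- Let n ≥ 1, 1 < p < ∞, and let f ∈ C_0^∞(ℝ^n \ {0}). Define the spherical L^p average U(r) = ((1/|σ|) ∫_{S^{n−1}} |f(ry)|^p dσ(y))^{1/p}, where |σ| is the surface measure of the unit sphere. Then for every r > 0, |U'(r)| ≤ ((1/|σ|) ∫_{S^{n−1}} |∂f/∂r (ry)|^p dσ(y))^{1/p}, and consequently ∫_{ℝ^n} |(x/|x|)·∇U(|x|)|^p |x|^{−αp} dx ≤ ∫_{ℝ^n} |(x/|x|)·∇f|^p |x|^{−αp} dx for every α ∈ ℝ. -/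
open Real MeasureTheory Metric

lemma aux_mink {S : Type*} [TopologicalSpace S] [CompactSpace S] [MeasurableSpace S] [BorelSpace S]
    (σ : Measure S) [IsFiniteMeasure σ] (p : ℝ) (hp : 1 < p) (g h : S → ℝ)
    (hg : Continuous g) (hh : Continuous h) :
    (∫ y, |g y| ^ p ∂σ) ^ (1 / p) ≤
      (∫ y, |h y| ^ p ∂σ) ^ (1 / p) + (∫ y, |g y - h y| ^ p ∂σ) ^ (1 / p) := by
  have hp0 : 0 < p := by linarith
  have key : ∀ k : S → ℝ, Continuous k →
      eLpNorm k (ENNReal.ofReal p) σ = ENNReal.ofReal ((∫ y, |k y| ^ p ∂σ) ^ (1 / p)) := by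
    intro k hk
    have hm : MemLp k (ENNReal.ofReal p) σ :=
      hk.memLp_of_hasCompactSupport (HasCompactSupport.of_compactSpace k)
    rw [hm.eLpNorm_eq_integral_rpow_norm (by simpa using hp0) (by simp)]
    simp [ENNReal.toReal_ofReal hp0.le]
  have h1 : eLpNorm (h + (g - h)) (ENNReal.ofReal p) σ ≤ _ :=
    eLpNorm_add_le hh.aestronglyMeasurable (hg.sub hh).aestronglyMeasurable
      (by simpa using hp.le)
  rw [add_sub_cancel, key g hg, key h hh, key (g - h) (hg.sub hh),
    ← ENNReal.ofReal_add (by positivity) (by positivity),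
    ENNReal.ofReal_le_ofReal_iff (by positivity)] at h1
  exact h1

lemma aux_deriv {E : Type*} [NormedAddCommGroup E] [NormedSpace ℝ E] [FiniteDimensional ℝ E]
    [MeasurableSpace E] [BorelSpace E] (σ : Measure (sphere (0 : E) 1)) [IsFiniteMeasure σ]
    (p : ℝ) (hp : 1 < p) (c : ℝ) (hc : 0 ≤ c)
    (f : E → ℝ) (hf : ContDiff ℝ (⊤ : ℕ∞) f) (hsupp : HasCompactSupport f) (r : ℝ) :
    |deriv (fun r : ℝ => (c * ∫ y : sphere (0 : E) 1, |f (r • (y : E))| ^ p ∂σ) ^ (1 / p)) r| ≤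
      (c * ∫ y : sphere (0 : E) 1, |fderiv ℝ f (r • (y : E)) (y : E)| ^ p ∂σ) ^ (1 / p) := by
  have hp0 : 0 < p := by linarith
  set U : ℝ → ℝ := fun r : ℝ => (c * ∫ y : sphere (0 : E) 1, |f (r • (y : E))| ^ p ∂σ) ^ (1 / p)
    with hU
  have hfc : Continuous f := hf.continuous
  have hgc : ∀ s : ℝ, Continuous (fun y : sphere (0 : E) 1 => f (s • (y : E))) := by
    intro s; fun_prop
  have hI : ∀ g : sphere (0 : E) 1 → ℝ, 0 ≤ ∫ y, |g y| ^ p ∂σ := fun g =>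
    integral_nonneg fun y => by positivity
  by_cases hd : DifferentiableAt ℝ U r
  swap
  · rw [deriv_zero_of_not_differentiableAt hd, abs_zero]
    exact rpow_nonneg (mul_nonneg hc (hI _)) _
  have hle : ∀ s t : ℝ, U s - U t ≤
      (c * ∫ y : sphere (0 : E) 1, |f (s • (y : E)) - f (t • (y : E))| ^ p ∂σ) ^ (1 / p) := by
    intro s t
    have := aux_mink σ p hp _ _ (hgc s) (hgc t)
    simp only [hU]
    rw [mul_rpow hc (hI _), mul_rpow hc (hI _), mul_rpow hc (hI fun y => f (s • (y : E)) - f (t • (y : E)))]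
    have h2 := mul_le_mul_of_nonneg_left this (rpow_nonneg hc (1 / p))
    linarith
  have habs : ∀ s t : ℝ, |U s - U t| ≤
      (c * ∫ y : sphere (0 : E) 1, |f (s • (y : E)) - f (t • (y : E))| ^ p ∂σ) ^ (1 / p) := by
    intro s t
    rw [abs_sub_le_iff]
    refine ⟨hle s t, ?_⟩
    have := hle t s
    simpa only [abs_sub_comm] using this
  have hslope : ∀ s : ℝ, s ≠ r → |slope U r s| ≤
      (c * ∫ y : sphere (0 : E) 1, |slope (fun s : ℝ => f (s • (y : E))) r s| ^ p ∂σ) ^ (1 / p) := by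
    intro s hs
    have hpos : 0 < |s - r| := abs_pos.2 (sub_ne_zero.2 hs)
    have e1 : ∀ y : sphere (0 : E) 1, |slope (fun s : ℝ => f (s • (y : E))) r s| ^ p =
        (|s - r|⁻¹) ^ p * |f (s • (y : E)) - f (r • (y : E))| ^ p := by
      intro y
      rw [slope_def_field, div_eq_inv_mul, abs_mul, abs_inv, mul_rpow (by positivity) (abs_nonneg _)]
    simp_rw [e1]
    rw [integral_const_mul, mul_left_comm, mul_rpow (by positivity)
      (mul_nonneg hc (hI fun y => f (s • (y : E)) - f (r • (y : E)))), one_div,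
      rpow_rpow_inv (by positivity) hp0.ne', slope_def_field, div_eq_inv_mul, abs_mul, abs_inv]
    have := habs s r
    rw [one_div] at this
    gcongr
  obtain ⟨K, hK⟩ := ContDiff.lipschitzWith_of_hasCompactSupport (𝕂 := ℝ) hsupp hf (by simp)
  have hlim : Filter.Tendsto (fun s => ∫ y : sphere (0 : E) 1,
      |slope (fun s : ℝ => f (s • (y : E))) r s| ^ p ∂σ) (nhdsWithin r {r}ᶜ)
      (nhds (∫ y : sphere (0 : E) 1, |fderiv ℝ f (r • (y : E)) (y : E)| ^ p ∂σ)) := by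
    refine tendsto_integral_filter_of_dominated_convergence (fun _ => (K : ℝ) ^ p) ?_ ?_
      (integrable_const _) ?_
    · refine Filter.Eventually.of_forall fun s => Continuous.aestronglyMeasurable ?_
      simp only [slope_def_field]
      refine Continuous.rpow_const ?_ (fun _ => Or.inr hp0.le)
      exact (((hgc s).sub (hgc r)).div_const _).abs
    · filter_upwards [self_mem_nhdsWithin] with s hs
      refine Filter.Eventually.of_forall fun y => ?_
      have hpos : 0 < |s - r| := abs_pos.2 (sub_ne_zero.2 hs)
      rw [norm_of_nonneg (by positivity)]
      refine rpow_le_rpow (abs_nonneg _) ?_ hp0.le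
      rw [slope_def_field, abs_div, div_le_iff₀ hpos]
      have := hK.dist_le_mul (s • (y : E)) (r • (y : E))
      rw [dist_eq_norm, dist_eq_norm, ← sub_smul, norm_smul, norm_eq_of_mem_sphere] at this
      simpa using this
    · refine Filter.Eventually.of_forall fun y => ?_
      have h1 : HasDerivAt (fun s : ℝ => f (s • (y : E))) (fderiv ℝ f (r • (y : E)) (y : E)) r := by
        have h2 : HasDerivAt (fun s : ℝ => s • (y : E)) (y : E) r := by
          simpa using (hasDerivAt_id r).smul_const (y : E)
        exact ((hf.differentiable (by simp)) _).hasFDerivAt.comp_hasDerivAt r h2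
      exact h1.tendsto_slope.abs.rpow_const (Or.inr hp0.le)
  refine le_of_tendsto_of_tendsto hd.hasDerivAt.tendsto_slope.abs
    ((hlim.const_mul c).rpow_const (Or.inr (by positivity))) ?_
  filter_upwards [self_mem_nhdsWithin] with s hs using hslope s hs

lemma aux_polar {E : Type*} [NormedAddCommGroup E] [NormedSpace ℝ E] [FiniteDimensional ℝ E]
    [Nontrivial E] [MeasurableSpace E] [BorelSpace E] (μ : Measure E) [μ.IsAddHaarMeasure]
    (G : E → ℝ) :
    (∫ x, G x ∂μ = ∫ z : sphere (0 : E) 1 × Set.Ioi (0 : ℝ), G ((z.2 : ℝ) • (z.1 : E))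
      ∂(μ.toSphere.prod (Measure.volumeIoiPow (Module.finrank ℝ E - 1)))) ∧
    (Integrable G μ → Integrable
      (fun z : sphere (0 : E) 1 × Set.Ioi (0 : ℝ) => G ((z.2 : ℝ) • (z.1 : E)))
      (μ.toSphere.prod (Measure.volumeIoiPow (Module.finrank ℝ E - 1)))) := by
  have hcomp : ∀ x : ({(0 : E)}ᶜ : Set E),
      (((homeomorphUnitSphereProd E x).2 : ℝ) • ((homeomorphUnitSphereProd E x).1 : E)) = x := by
    intro x
    have h0 : ‖(x : E)‖ ≠ 0 := norm_ne_zero_iff.2 x.2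
    simp [smul_smul, h0]
  constructor
  · rw [← μ.measurePreserving_homeomorphUnitSphereProd.integral_comp
        (Homeomorph.measurableEmbedding _)]
    simp only [hcomp]
    rw [integral_subtype_comap (measurableSet_singleton _).compl fun x ↦ G x,
        restrict_compl_singleton]
  · intro h
    rw [← μ.measurePreserving_homeomorphUnitSphereProd.integrable_comp_emb
      (Homeomorph.measurableEmbedding _)]
    simp only [Function.comp_def, hcomp]
    rw [← restrict_compl_singleton (μ := μ) 0, ← IntegrableOn,
      integrableOn_iff_comap_subtypeVal (measurableSet_singleton _).compl] at h
    exact h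

lemma aux_int {E : Type*} [NormedAddCommGroup E] [NormedSpace ℝ E] [FiniteDimensional ℝ E]
    [MeasurableSpace E] [BorelSpace E] (μ : Measure E) [μ.IsAddHaarMeasure]
    (p : ℝ) (hp : 1 < p) (β : ℝ)
    (f : E → ℝ) (hf : ContDiff ℝ (⊤ : ℕ∞) f) (hsupp : HasCompactSupport f)
    (h0 : ∃ ε > (0 : ℝ), ∀ x : E, ‖x‖ < ε → f x = 0) :
    Integrable (fun x => |fderiv ℝ f x (‖x‖⁻¹ • x)| ^ p * ‖x‖ ^ β) μ := by
  have hp0 : 0 < p := by linarith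
  have hfd : Continuous (fderiv ℝ f) := hf.continuous_fderiv (by simp)
  apply Continuous.integrable_of_hasCompactSupport
  · rw [continuous_iff_continuousAt]
    intro x
    by_cases hx : x = 0
    · subst hx
      obtain ⟨ε, hε, h⟩ := h0
      have : (fun x => |fderiv ℝ f x (‖x‖⁻¹ • x)| ^ p * ‖x‖ ^ β) =ᶠ[nhds 0] fun _ => (0 : ℝ) := by
        filter_upwards [ball_mem_nhds (0 : E) hε] with x hx
        have h1 : f =ᶠ[nhds x] fun _ => (0 : ℝ) := by
          filter_upwards [isOpen_ball.mem_nhds hx] with z hz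
          exact h z (by simpa using hz)
        rw [h1.fderiv_eq]
        simp [hp0.ne']
      exact continuousAt_const.congr this.symm
    · have hn : ‖x‖ ≠ 0 := norm_ne_zero_iff.2 hx
      refine ContinuousAt.mul ?_ (continuousAt_id.norm.rpow_const (Or.inl hn))
      refine ContinuousAt.rpow_const (ContinuousAt.abs ?_) (Or.inr hp0.le)
      exact hfd.continuousAt.clm_apply ((continuousAt_id.norm.inv₀ hn).smul continuousAt_id)
  · refine (hsupp.fderiv ℝ).mono ?_
    intro x hx hx'
    apply hx
    simp [hx', hp0.ne']

theorem stmt_17 (n : ℕ) (hn : 1 ≤ n) (p : ℝ) (hp : 1 < p)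
    (f : EuclideanSpace ℝ (Fin n) → ℝ) (hf : ContDiff ℝ (⊤ : ℕ∞) f) (hsupp : HasCompactSupport f)
    (h0 : ∃ ε > (0 : ℝ), ∀ x : EuclideanSpace ℝ (Fin n), ‖x‖ < ε → f x = 0) :
    let σ : Measure (sphere (0 : EuclideanSpace ℝ (Fin n)) 1) :=
      (volume : Measure (EuclideanSpace ℝ (Fin n))).toSphere
    let σvol : ℝ := (σ Set.univ).toReal
    let U : ℝ → ℝ := fun r =>
      ((1 / σvol) * ∫ y : sphere (0 : EuclideanSpace ℝ (Fin n)) 1,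
        |f (r • (y : EuclideanSpace ℝ (Fin n)))| ^ p ∂σ) ^ (1 / p)
    (∀ r : ℝ, 0 < r →
      |deriv U r| ≤ ((1 / σvol) * ∫ y : sphere (0 : EuclideanSpace ℝ (Fin n)) 1,
        |fderiv ℝ f (r • (y : EuclideanSpace ℝ (Fin n))) (y : EuclideanSpace ℝ (Fin n))| ^ p
          ∂σ) ^ (1 / p)) ∧
    ∀ α : ℝ,
      ∫ x : EuclideanSpace ℝ (Fin n), |deriv U ‖x‖| ^ p * ‖x‖ ^ (-(α * p)) ≤
        ∫ x : EuclideanSpace ℝ (Fin n),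
          |fderiv ℝ f x (‖x‖⁻¹ • x)| ^ p * ‖x‖ ^ (-(α * p)) := by
  intro σ σvol U
  haveI : Nonempty (Fin n) := ⟨⟨0, hn⟩⟩
  haveI : Nontrivial (EuclideanSpace ℝ (Fin n)) := inferInstance
  have hp0 : 0 < p := by linarith
  have hσ : 0 < σvol := by
    refine ENNReal.toReal_pos ?_ (measure_ne_top _ _)
    exact Measure.measure_univ_ne_zero.2 (Measure.toSphere_ne_zero _)
  have hmain : ∀ r : ℝ, 0 < r →
      |deriv U r| ≤ ((1 / σvol) * ∫ y : sphere (0 : EuclideanSpace ℝ (Fin n)) 1,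
        |fderiv ℝ f (r • (y : EuclideanSpace ℝ (Fin n))) (y : EuclideanSpace ℝ (Fin n))| ^ p
          ∂σ) ^ (1 / p) := fun r _ =>
    aux_deriv σ p hp (1 / σvol) (by positivity) f hf hsupp r
  refine ⟨hmain, fun α => ?_⟩
  have hint := aux_int (volume : Measure (EuclideanSpace ℝ (Fin n))) p hp (-(α * p)) f hf hsupp h0
  obtain ⟨hR1, hR2⟩ := aux_polar (volume : Measure (EuclideanSpace ℝ (Fin n)))
    (fun x => |fderiv ℝ f x (‖x‖⁻¹ • x)| ^ p * ‖x‖ ^ (-(α * p)))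
  have hR3 := hR2 hint
  rw [hR1, integral_prod_symm _ hR3,
    (aux_polar (volume : Measure (EuclideanSpace ℝ (Fin n)))
    (fun x => |deriv U ‖x‖| ^ p * ‖x‖ ^ (-(α * p)))).1]
  have hnorm : ∀ (y : sphere (0 : EuclideanSpace ℝ (Fin n)) 1) (r : Set.Ioi (0 : ℝ)),
      ‖(r : ℝ) • (y : EuclideanSpace ℝ (Fin n))‖ = r := by
    intro y r
    rw [norm_smul, norm_eq_of_mem_sphere, mul_one, norm_of_nonneg (le_of_lt r.2)]
  have hL : ∀ z : sphere (0 : EuclideanSpace ℝ (Fin n)) 1 × Set.Ioi (0 : ℝ),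
      |deriv U ‖(z.2 : ℝ) • (z.1 : EuclideanSpace ℝ (Fin n))‖| ^ p *
        ‖(z.2 : ℝ) • (z.1 : EuclideanSpace ℝ (Fin n))‖ ^ (-(α * p)) =
      |deriv U z.2| ^ p * (z.2 : ℝ) ^ (-(α * p)) := by
    intro z; rw [hnorm]
  simp only [hL]
  have hsnd := integral_fun_snd (μ := σ)
    (ν := Measure.volumeIoiPow (Module.finrank ℝ (EuclideanSpace ℝ (Fin n)) - 1))
    (fun r : Set.Ioi (0 : ℝ) => |deriv U r| ^ p * (r : ℝ) ^ (-(α * p)))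
  rw [hsnd, smul_eq_mul, ← integral_const_mul]
  refine integral_mono_of_nonneg (Filter.Eventually.of_forall fun r => ?_)
    hR3.integral_prod_right (Filter.Eventually.of_forall fun r => ?_)
  · have : (0 : ℝ) < r := r.2
    simp only [Pi.zero_apply]
    positivity
  · have hr : (0 : ℝ) < r := r.2
    have hinner : ∀ y : sphere (0 : EuclideanSpace ℝ (Fin n)) 1,
        ((r : ℝ)⁻¹ • ((r : ℝ) • (y : EuclideanSpace ℝ (Fin n)))) = y := by
      intro y
      rw [smul_smul, inv_mul_cancel₀ hr.ne', one_smul]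
    simp only [hnorm, hinner]
    rw [integral_mul_const, ← mul_assoc]
    refine mul_le_mul_of_nonneg_right ?_ (by positivity)
    have hI : 0 ≤ ∫ y : sphere (0 : EuclideanSpace ℝ (Fin n)) 1,
        |fderiv ℝ f ((r : ℝ) • (y : EuclideanSpace ℝ (Fin n)))
          (y : EuclideanSpace ℝ (Fin n))| ^ p ∂σ := integral_nonneg fun y => by positivity
    have h1 := rpow_le_rpow (abs_nonneg _) (hmain r hr) hp0.le
    rw [one_div p, rpow_inv_rpow (by positivity) hp0.ne', one_div, ← div_eq_inv_mul,
      le_div_iff₀ hσ, mul_comm] at h1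
    exact h1
end

section
/- Let n ≥ 3, 2 ≤ p < n, −∞ < α < (n−p)/p. For a radial function f ∈ C_0^∞(ℝ^n \ {0}) with f(x) = f̃(|x|), set c_f(R) = R^{(n−p−αp)/p} f̃(R) and f_α(x) = |x|^{−(n−p−αp)/p}. Then ∫_{ℝ^n} |∇f|^p/|x|^{αp} dx − ((n−p−αp)/p)^p ∫_{ℝ^n} |f|^p/|x|^{(α+1)p} dx ≥ c_p ((p−1)/p)^p · sup_{R>0} ∫_{ℝ^n} |f(x) − c_f(R) f_α(x)|^p / (|log(R/|x|)|^p |x|^{(α+1)p}) dx, where c_p = min_{0<t≤1/2}((1−t)^p − t^p + pt^{p−1}). -/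
open Real MeasureTheory Set

lemma tangent_aux (q x y : ℝ) (hq : 1 ≤ q) (hx : 0 < x) (hy : 0 ≤ y) :
    x ^ q + q * x ^ (q - 1) * (y - x) ≤ y ^ q := by
  have h := one_add_mul_self_le_rpow_one_add (s := y / x - 1) (p := q) (by have := div_nonneg hy hx.le; linarith) hq
  have h2 : (1 + (y / x - 1)) ^ q = y ^ q / x ^ q := by
    rw [add_sub_cancel, Real.div_rpow hy hx.le]
  rw [h2, le_div_iff₀ (Real.rpow_pos_of_pos hx q)] at h
  have h3 : x ^ q = x ^ (q - 1) * x := by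
    rw [← Real.rpow_add_one hx.ne']; ring_nf
  have h4 : (1 + q * (y / x - 1)) * x ^ q = x ^ q + q * x ^ (q - 1) * (y - x) := by
    rw [h3]; field_simp
  linarith

noncomputable def Hfun (p a : ℝ) : ℝ := |a - 1| ^ p - |a| ^ p + p * (|a| ^ (p - 2) * a)

lemma Hfun_eq {p a : ℝ} (hp2 : 2 ≤ p) (ha : 0 ≤ a) (ha1 : a ≤ 1) : Hfun p a = (1 - a) ^ p - a ^ p + p * a ^ (p - 1) := by
  unfold Hfun
  rw [abs_sub_comm, abs_of_nonneg (sub_nonneg.2 ha1), abs_of_nonneg ha]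
  rcases ha.eq_or_lt with rfl | h
  · rw [Real.zero_rpow (x := p - 1) (by linarith)]; simp
  · rw [← Real.rpow_add_one h.ne']; ring_nf

lemma inf_le_aux {p : ℝ} (hp2 : 2 ≤ p) :
    0 ≤ sInf ((fun t : ℝ => (1 - t) ^ p - t ^ p + p * t ^ (p - 1)) '' Ioc (0 : ℝ) (1 / 2)) ∧
    (∀ t ∈ Icc (0:ℝ) (1/2), sInf ((fun t : ℝ => (1 - t) ^ p - t ^ p + p * t ^ (p - 1)) '' Ioc (0 : ℝ) (1 / 2)) ≤ Hfun p t) := by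
  set S := ((fun t : ℝ => (1 - t) ^ p - t ^ p + p * t ^ (p - 1)) '' Ioc (0 : ℝ) (1 / 2)) with hS
  have hnn : ∀ y ∈ S, 0 ≤ y := by
    rintro _ ⟨t, ⟨h0, h1⟩, rfl⟩
    have : t ^ p ≤ (1 - t) ^ p := Real.rpow_le_rpow h0.le (by linarith) (by linarith)
    have : 0 ≤ p * t ^ (p - 1) := by positivity
    simp only; linarith
  have hbdd : BddBelow S := ⟨0, hnn⟩
  have hle : ∀ t ∈ Ioc (0:ℝ) (1/2), sInf S ≤ Hfun p t := by
    intro t ht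
    rw [Hfun_eq hp2 ht.1.le (by linarith [ht.2])]
    exact csInf_le hbdd ⟨t, ht, rfl⟩
  refine ⟨Real.sInf_nonneg hnn, ?_⟩
  intro t ht
  rcases ht.1.eq_or_lt with rfl | h
  · have hc : ContinuousAt (fun t : ℝ => (1 - t) ^ p - t ^ p + p * t ^ (p - 1)) 0 := by
      apply ContinuousAt.add
      · apply ContinuousAt.sub
        · exact (by fun_prop : ContinuousAt (fun t : ℝ => 1 - t) 0).rpow_const (Or.inr (by linarith))
        · exact continuousAt_id.rpow_const (Or.inr (by linarith))
      · exact continuousAt_const.mul (continuousAt_id.rpow_const (Or.inr (by linarith)))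
    have hc2 := hc.continuousWithinAt (s := Ioi 0)
    rw [Hfun_eq hp2 le_rfl zero_le_one]
    apply ge_of_tendsto hc2
    filter_upwards [Ioc_mem_nhdsGT (show (0:ℝ) < 1/2 by norm_num)] with t ht
    exact csInf_le hbdd ⟨t, ht, rfl⟩
  · exact hle t ⟨h, ht.2⟩

lemma Hfun_deriv {p : ℝ} (hp2 : 2 ≤ p) (a : ℝ) (ha : a ≠ 0) :
    HasDerivAt (Hfun p) (p * (|a - 1| ^ (p - 2) * (a - 1) - |a| ^ (p - 2) * a + (p - 1) * |a| ^ (p - 2))) a := by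
  have h1 : HasDerivAt (fun a : ℝ => |a - 1| ^ p) (p * |a - 1| ^ (p - 2) * (a - 1)) a := by
    exact (hasDerivAt_abs_rpow (a - 1) (p := p) (by linarith)).comp_sub_const a 1
  have h2 := hasDerivAt_abs_rpow a (p := p) (by linarith)
  have h3 := ((hasDerivAt_abs ha).rpow_const (p := p - 2) (Or.inl (abs_ne_zero.2 ha))).mul (hasDerivAt_id a)
  have h4 := (h1.sub h2).add (h3.const_mul p)
  refine h4.congr_deriv ?_
  have e1 : |a| ^ (p - 2) = |a| ^ (p - 2 - 1) * |a| := by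
    rw [← Real.rpow_add_one (abs_ne_zero.2 ha)]; ring_nf
  have e2 : ((SignType.sign a : SignType) : ℝ) * a = |a| := by
    exact sign_mul_self a
  simp only [id]
  linear_combination p * (p - 2) * |a| ^ (p - 2 - 1) * e2 - p * (p - 2) * e1

lemma Hfun_cont {p : ℝ} (hp2 : 2 ≤ p) : Continuous (Hfun p) := by
  unfold Hfun
  have h1 : Continuous fun a : ℝ => |a - 1| ^ p := (by fun_prop : Continuous fun a : ℝ => |a-1|).rpow_const (fun _ => Or.inr (by linarith))
  have h2 : Continuous fun a : ℝ => |a| ^ p := (by fun_prop : Continuous fun a : ℝ => |a|).rpow_const (fun _ => Or.inr (by linarith))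
  have h3 : Continuous fun a : ℝ => |a| ^ (p-2) := (by fun_prop : Continuous fun a : ℝ => |a|).rpow_const (fun _ => Or.inr (by linarith))
  fun_prop

lemma Hfun_mono {p : ℝ} (hp2 : 2 ≤ p) : MonotoneOn (Hfun p) (Ici (1/2)) := by
  apply monotoneOn_of_deriv_nonneg (convex_Ici _) (Hfun_cont hp2).continuousOn
  · intro a ha
    rw [interior_Ici] at ha
    exact (Hfun_deriv hp2 a (by have : (1/2:ℝ) < a := ha; linarith)).differentiableAt.differentiableWithinAt
  · intro a ha
    rw [interior_Ici] at ha
    have ha' : (1/2:ℝ) < a := ha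
    have ha0 : 0 < a := by linarith
    rw [(Hfun_deriv hp2 a ha0.ne').deriv]
    apply mul_nonneg (by linarith)
    rw [abs_of_pos ha0]
    have hpos := Real.rpow_nonneg ha0.le (p - 2)
    rcases le_total a 1 with h | h
    · rw [abs_sub_comm, abs_of_nonneg (sub_nonneg.2 h)]
      have : (1 - a) ^ (p - 2) ≤ a ^ (p - 2) := Real.rpow_le_rpow (by linarith) (by linarith) (by linarith)
      nlinarith
    · rw [abs_of_nonneg (sub_nonneg.2 h)]
      have h1 := tangent_aux (p - 1) a (a - 1) (by linarith) ha0 (by linarith)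
      have e1 : a ^ (p - 1) = a ^ (p - 2) * a := by
        rw [← Real.rpow_add_one ha0.ne']; ring_nf
      have e2 : (a - 1) ^ (p - 1) = (a - 1) ^ (p - 2) * (a - 1) := by
        rcases h.eq_or_lt with rfl | h
        · rw [sub_self, mul_zero, Real.zero_rpow (by linarith)]
        · rw [← Real.rpow_add_one (sub_pos.2 h).ne']; ring_nf
      have e3 : p - 1 - 1 = p - 2 := by ring
      rw [e3] at h1
      nlinarith

lemma Hfun_anti {p : ℝ} (hp2 : 2 ≤ p) : AntitoneOn (Hfun p) (Iic 0) := by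
  apply antitoneOn_of_deriv_nonpos (convex_Iic _) (Hfun_cont hp2).continuousOn
  · intro a ha
    rw [interior_Iic] at ha
    exact (Hfun_deriv hp2 a (by have : a < 0 := ha; linarith)).differentiableAt.differentiableWithinAt
  · intro a ha
    rw [interior_Iic] at ha
    have ha0 : a < 0 := ha
    rw [(Hfun_deriv hp2 a ha0.ne).deriv]
    apply mul_nonpos_of_nonneg_of_nonpos (by linarith)
    obtain ⟨s, rfl⟩ : ∃ s, a = -s := ⟨-a, by ring⟩
    have hs : 0 < s := by linarith
    rw [abs_neg, abs_of_pos hs, show -s - 1 = -(1 + s) by ring, abs_neg, abs_of_pos (by linarith : 0 < 1 + s)]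
    have h1 := tangent_aux (p - 1) s (1 + s) (by linarith) hs (by linarith)
    have e1 : s ^ (p - 1) = s ^ (p - 2) * s := by
      rw [← Real.rpow_add_one hs.ne']; ring_nf
    have e2 : (1 + s) ^ (p - 1) = (1 + s) ^ (p - 2) * (1 + s) := by
      rw [← Real.rpow_add_one (by linarith : 1 + s ≠ 0)]; ring_nf
    have e3 : p - 1 - 1 = p - 2 := by ring
    rw [e3] at h1
    nlinarith

noncomputable def cP (p : ℝ) : ℝ :=
  sInf ((fun t : ℝ => (1 - t) ^ p - t ^ p + p * t ^ (p - 1)) '' Ioc (0 : ℝ) (1 / 2))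

lemma cP_nonneg {p : ℝ} (hp2 : 2 ≤ p) : 0 ≤ cP p := (inf_le_aux hp2).1

lemma cP_le {p : ℝ} (hp2 : 2 ≤ p) (a : ℝ) : cP p ≤ Hfun p a := by
  rcases le_total a 0 with h | h
  · exact ((inf_le_aux hp2).2 0 (by norm_num)).trans (Hfun_anti hp2 h (mem_Iic.2 (le_refl (0:ℝ))) h)
  · rcases le_total a (1/2) with h' | h'
    · exact (inf_le_aux hp2).2 a ⟨h, h'⟩
    · exact ((inf_le_aux hp2).2 (1/2) (by norm_num)).trans (Hfun_mono hp2 (mem_Ici.2 (le_refl (1/2:ℝ))) h' h')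

lemma abs_rpow_two {p : ℝ} (hp2 : 2 ≤ p) (a : ℝ) : |a| ^ (p - 2) * a * a = |a| ^ p := by
  by_cases ha : a = 0
  · subst ha; rw [abs_zero, Real.zero_rpow (x := p) (by linarith)]; simp
  · have e : |a| ^ p = |a| ^ (p - 2) * |a| ^ (2:ℕ) := by
      rw [← Real.rpow_natCast, ← Real.rpow_add (abs_pos.2 ha)]; norm_num
    rw [e, sq_abs]; ring

lemma pointwise {p : ℝ} (hp2 : 2 ≤ p) (a b : ℝ) :
    |a| ^ p - p * (|a| ^ (p - 2) * a * b) + cP p * |b| ^ p ≤ |b - a| ^ p := by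
  by_cases hb : b = 0
  · subst hb; rw [abs_zero, Real.zero_rpow (x := p) (by linarith)]; simp
  have h := cP_le hp2 (a / b)
  have hB : 0 < |b| := abs_pos.2 hb
  have hBp := Real.rpow_pos_of_pos hB p
  have e1 : |b - a| ^ p = |a / b - 1| ^ p * |b| ^ p := by
    rw [← Real.mul_rpow (abs_nonneg _) (abs_nonneg _), ← abs_mul, abs_sub_comm]
    congr 2; field_simp
  have e2 : |a| ^ p = |a / b| ^ p * |b| ^ p := by
    rw [← Real.mul_rpow (abs_nonneg _) (abs_nonneg _), ← abs_mul]
    congr 2; field_simp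
  have e3 : |a| ^ (p - 2) * a * b = |a / b| ^ (p - 2) * (a / b) * |b| ^ p := by
    rw [← abs_rpow_two hp2 b]
    have : |a| ^ (p - 2) = |a / b| ^ (p - 2) * |b| ^ (p - 2) := by
      rw [← Real.mul_rpow (abs_nonneg _) (abs_nonneg _), ← abs_mul]
      congr 2; field_simp
    rw [this]; field_simp
  rw [e1, e2, e3]
  have h2 := mul_le_mul_of_nonneg_right h hBp.le
  unfold Hfun at h2
  linarith

lemma young {p : ℝ} (hp2 : 2 ≤ p) (a b : ℝ) :
    p * (|a| ^ (p - 2) * a * b) - (p - 1) * |a| ^ p ≤ |b| ^ p := by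
  have h := pointwise hp2 a (a - b)
  have h2 : 0 ≤ cP p * |a - b| ^ p := mul_nonneg (cP_nonneg hp2) (by positivity)
  have h3 := abs_rpow_two hp2 a
  have h4 : |a - b - a| = |b| := by rw [show a - b - a = -b by ring, abs_neg]
  rw [h4] at h
  have : |a| ^ (p - 2) * a * (a - b) = |a| ^ p - |a| ^ (p - 2) * a * b := by rw [← h3]; ring
  rw [this] at h
  linarith

lemma hardy_pointwise {p : ℝ} (hp2 : 2 ≤ p) (t v w : ℝ) (ht : 0 < t) :
    ((p - 1) / p) ^ (p - 1) * ((p * |v| ^ (p - 2) * v * w) * t ^ (1 - p) + |v| ^ p * ((1 - p) * t ^ (1 - p - 1)))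
      ≤ |w| ^ p - ((p - 1) / p) ^ p * (|v| ^ p / |t| ^ p) := by
  set k := (p - 1) / p with hk
  have hkp : 0 < k := div_pos (by linarith) (by linarith)
  have hpk : k * p = p - 1 := by rw [hk]; field_simp
  have hy := young hp2 (k * v / t) w
  have eA : |k * v / t| ^ (p - 2) = k ^ (p - 2) * |v| ^ (p - 2) / t ^ (p - 2) := by
    rw [abs_div, abs_mul, abs_of_pos hkp, abs_of_pos ht, Real.div_rpow (by positivity) ht.le,
      Real.mul_rpow hkp.le (abs_nonneg _)]
  rw [← abs_rpow_two hp2 (k * v / t), eA] at hy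
  rw [abs_of_pos ht, ← abs_rpow_two hp2 v]
  have e1 : t ^ p = t ^ (p - 2) * t ^ 2 := by
    rw [← Real.rpow_natCast, ← Real.rpow_add ht]; norm_num
  have e2 : k ^ p = k ^ (p - 2) * k ^ 2 := by
    rw [← Real.rpow_natCast, ← Real.rpow_add hkp]; norm_num
  have e3 : k ^ (p - 1) = k ^ (p - 2) * k := by
    rw [← Real.rpow_add_one hkp.ne']; ring_nf
  have e4 : t ^ (1 - p) = (t ^ (p - 2) * t)⁻¹ := by
    rw [← Real.rpow_add_one ht.ne', ← Real.rpow_neg ht.le]; ring_nf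
  have e5 : t ^ (1 - p - 1) = (t ^ (p - 2) * t ^ 2)⁻¹ := by
    rw [← e1, ← Real.rpow_neg ht.le]; ring_nf
  rw [e1, e2, e3, e4, e5]
  have hτ := Real.rpow_pos_of_pos ht (p - 2)
  generalize t ^ (p - 2) = τ at *
  generalize k ^ (p - 2) = κ at *
  generalize |v| ^ (p - 2) = X at *
  refine le_of_eq_of_le ?_ (sub_le_sub_right hy _)
  clear_value k
  linear_combination (κ * X * v ^ 2 * k / (τ * t ^ 2)) * hpk

lemma hardy_half {p : ℝ} (hp2 : 2 ≤ p) (v v' : ℝ → ℝ) (hv : ∀ t, HasDerivAt v (v' t) t)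
    (L : ℝ) (hL : ∀ t, |v t| ≤ L * |t|)
    (hi : IntegrableOn (fun t => |v' t| ^ p) (Ioi 0))
    (hG : IntegrableOn (fun t => |v t| ^ p / |t| ^ p) (Ioi 0)) :
    ((p - 1) / p) ^ p * ∫ t in Ioi (0:ℝ), |v t| ^ p / |t| ^ p ≤ ∫ t in Ioi (0:ℝ), |v' t| ^ p := by
  have hL0 : 0 ≤ L := by have := (abs_nonneg _).trans (hL 1); simpa using this
  have hv0 : v 0 = 0 := by have := hL 0; simpa using this
  rw [← sub_nonneg, ← integral_const_mul, ← integral_sub hi (hG.const_mul _)]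
  have hφ : IntegrableOn (fun t => |v' t| ^ p - ((p - 1) / p) ^ p * (|v t| ^ p / |t| ^ p)) (Ioi 0) :=
    hi.sub (hG.const_mul _)
  refine ge_of_tendsto (intervalIntegral_tendsto_integral_Ioi 0 hφ Filter.tendsto_id) ?_
  filter_upwards [Filter.eventually_ge_atTop (0:ℝ)] with T hT
  simp only [id]
  have hvc : Continuous v := continuous_iff_continuousAt.2 fun t => (hv t).continuousAt
  set g : ℝ → ℝ := fun t => ((p - 1) / p) ^ (p - 1) * (|v t| ^ p * t ^ (1 - p)) with hg
  have hk : 0 < (p - 1) / p := div_pos (by linarith) (by linarith)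
  have key := intervalIntegral.sub_le_integral_of_hasDeriv_right_of_le (a := 0) (b := T) (g := g)
    (g' := fun t => ((p - 1) / p) ^ (p - 1) * ((p * |v t| ^ (p - 2) * v t * v' t) * t ^ (1 - p) + |v t| ^ p * ((1 - p) * t ^ (1 - p - 1))))
    (φ := fun t => |v' t| ^ p - ((p - 1) / p) ^ p * (|v t| ^ p / |t| ^ p)) hT ?_ ?_ ?_ ?_
  · have g0 : g 0 = 0 := by
      simp only [hg, hv0, abs_zero]; rw [Real.zero_rpow (x := p) (by linarith)]; simp
    have gT : 0 ≤ g T := by simp only [hg]; positivity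
    linarith
  · apply ContinuousOn.mul continuousOn_const
    intro t ht
    rcases ht.1.eq_or_lt with rfl | h
    · unfold ContinuousWithinAt
      simp only [hv0, abs_zero]
      rw [Real.zero_rpow (x := p) (by linarith), zero_mul]
      have hlim : Filter.Tendsto (fun t : ℝ => L ^ p * t) (nhdsWithin 0 (Icc 0 T)) (nhds 0) := by
        have : ContinuousAt (fun t : ℝ => L ^ p * t) 0 := by fun_prop
        have h2 := this.continuousWithinAt (s := Icc 0 T)
        unfold ContinuousWithinAt at h2
        simpa using h2
      refine tendsto_of_tendsto_of_tendsto_of_le_of_le' tendsto_const_nhds hlim ?_ ?_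
      · filter_upwards [self_mem_nhdsWithin] with t ht
        have := ht.1
        positivity
      · filter_upwards [self_mem_nhdsWithin] with t ht
        rcases ht.1.eq_or_lt with rfl | h
        · simp only [hv0, abs_zero]; rw [Real.zero_rpow (x := p) (by linarith)]; simp
        · have h1 : |v t| ^ p ≤ L ^ p * t ^ p := by
            rw [← Real.mul_rpow hL0 h.le]
            have := hL t
            rw [abs_of_pos h] at this
            exact Real.rpow_le_rpow (abs_nonneg _) this (by linarith)
          calc |v t| ^ p * t ^ (1 - p) ≤ L ^ p * t ^ p * t ^ (1 - p) :=
                mul_le_mul_of_nonneg_right h1 (by positivity)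
            _ = L ^ p * t := by rw [mul_assoc, ← Real.rpow_add h]; simp
    · apply ContinuousAt.continuousWithinAt
      exact (hvc.abs.continuousAt.rpow_const (Or.inr (by linarith))).mul (continuousAt_id.rpow_const (Or.inl h.ne'))
  · intro t ht
    apply HasDerivAt.hasDerivWithinAt
    have h1 := (hasDerivAt_abs_rpow (v t) (p := p) (by linarith)).comp t (hv t)
    have h2 := Real.hasDerivAt_rpow_const (x := t) (p := 1 - p) (Or.inl ht.1.ne')
    exact (h1.mul h2).const_mul _
  · rw [integrableOn_Icc_iff_integrableOn_Ioc]
    exact hφ.mono_set Ioc_subset_Ioi_self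
  · intro t ht
    exact hardy_pointwise hp2 t (v t) (v' t) ht.1

lemma hardy_full {p : ℝ} (hp2 : 2 ≤ p) (v v' : ℝ → ℝ) (hv : ∀ t, HasDerivAt v (v' t) t)
    (L : ℝ) (hL : ∀ t, |v t| ≤ L * |t|)
    (hi : Integrable (fun t => |v' t| ^ p)) :
    ((p - 1) / p) ^ p * ∫ t, |v t| ^ p / |t| ^ p ≤ ∫ t, |v' t| ^ p := by
  by_cases hG : Integrable (fun t => |v t| ^ p / |t| ^ p)
  · have h1 := hardy_half hp2 v v' hv L hL hi.integrableOn hG.integrableOn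
    have h2 := hardy_half hp2 (fun t => v (-t)) (fun t => - v' (-t))
      (fun t => by simpa [Function.comp_def] using (hv (-t)).comp t (hasDerivAt_neg t)) L (fun t => by simpa using hL (-t))
      (by simpa [abs_neg] using hi.comp_neg.integrableOn)
      (by simpa [abs_neg] using hG.comp_neg.integrableOn)
    have e1 := integral_comp_neg_Ioi 0 (fun t => |v t| ^ p / |t| ^ p)
    have e2 := integral_comp_neg_Ioi 0 (fun t => |v' t| ^ p)
    simp only [abs_neg, neg_zero] at e1 e2 h2
    rw [e1, e2] at h2
    rw [← intervalIntegral.integral_Iic_add_Ioi hG.integrableOn hG.integrableOn (b := 0),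
      ← intervalIntegral.integral_Iic_add_Ioi hi.integrableOn hi.integrableOn (b := 0)]
    linarith
  · rw [integral_undef hG, mul_zero]
    exact integral_nonneg fun t => by positivity

lemma core {p : ℝ} (hp2 : 2 ≤ p) (q : ℝ) (hq : 0 ≤ q) (u : ℝ → ℝ) (hu : ContDiff ℝ 1 u)
    (hs : HasCompactSupport u) (s₀ : ℝ) :
    cP p * ((p - 1) / p) ^ p * ∫ s, |u s - u s₀| ^ p / |s₀ - s| ^ p ≤
      (∫ s, |deriv u s - q * u s| ^ p) - q ^ p * ∫ s, |u s| ^ p := by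
  have hp0 : p ≠ 0 := by linarith
  have hd : ∀ s, HasDerivAt u (deriv u s) s := fun s => (hu.differentiable (by norm_num) s).hasDerivAt
  have hdc : Continuous (deriv u) := hu.continuous_deriv le_rfl
  have hds : HasCompactSupport (deriv u) := hs.deriv
  have int_abs : ∀ w : ℝ → ℝ, Continuous w → HasCompactSupport w → Integrable (fun s => |w s| ^ p) := by
    intro w hw hws
    refine Continuous.integrable_of_hasCompactSupport (hw.abs.rpow_const fun _ => Or.inr (by linarith)) ?_
    exact hws.comp_left (g := fun x : ℝ => |x| ^ p) (by simp [hp0])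
  have iu := int_abs u hu.continuous hs
  have idu := int_abs _ hdc hds
  have iw := int_abs (fun s => deriv u s - q * u s) (by have := hu.continuous; fun_prop)
    (hds.sub (hs.mul_left (f := fun _ => q)))
  have h0 : ∫ s, p * |u s| ^ (p - 2) * u s * deriv u s = 0 := by
    apply integral_eq_zero_of_hasDerivAt_of_integrable (f := fun s => |u s| ^ p) _ _ iu
    · intro s
      exact (hasDerivAt_abs_rpow (u s) (p := p) (by linarith)).comp s (hd s)
    · apply Continuous.integrable_of_hasCompactSupport
      · have := hu.continuous
        have h3 : Continuous fun s => |u s| ^ (p-2) := this.abs.rpow_const (fun _ => Or.inr (by linarith))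
        fun_prop
      · exact hds.mul_left
  have h0i : Integrable (fun s => p * |u s| ^ (p - 2) * u s * deriv u s) := by
    apply Continuous.integrable_of_hasCompactSupport
    · have := hu.continuous
      have h3 : Continuous fun s => |u s| ^ (p-2) := this.abs.rpow_const (fun _ => Or.inr (by linarith))
      fun_prop
    · exact hds.mul_left
  have hmain : cP p * ∫ s, |deriv u s| ^ p ≤ (∫ s, |deriv u s - q * u s| ^ p) - q ^ p * ∫ s, |u s| ^ p := by
    have hi1 : Integrable (fun s => q ^ p * |u s| ^ p - (q ^ (p - 2) * q) * (p * |u s| ^ (p - 2) * u s * deriv u s)) :=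
      (iu.const_mul _).sub (h0i.const_mul _)
    have hi2 : Integrable (fun s => q ^ p * |u s| ^ p - (q ^ (p - 2) * q) * (p * |u s| ^ (p - 2) * u s * deriv u s) + cP p * |deriv u s| ^ p) :=
      hi1.add (idu.const_mul _)
    have : ∫ s, (q ^ p * |u s| ^ p - (q ^ (p - 2) * q) * (p * |u s| ^ (p - 2) * u s * deriv u s) + cP p * |deriv u s| ^ p)
        ≤ ∫ s, |deriv u s - q * u s| ^ p := by
      apply integral_mono hi2 iw
      intro s
      refine le_of_eq_of_le ?_ (pointwise hp2 (q * u s) (deriv u s))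
      simp only [abs_mul, abs_of_nonneg hq, Real.mul_rpow hq (abs_nonneg _)]
      ring
    rw [integral_add hi1 (idu.const_mul _),
      integral_sub (iu.const_mul _) (h0i.const_mul _), integral_const_mul, integral_const_mul, integral_const_mul, h0] at this
    linarith
  obtain ⟨C, hC⟩ := hds.exists_bound_of_continuous hdc
  have hh := hardy_full hp2 (fun t => u (t + s₀) - u s₀) (fun t => deriv u (t + s₀))
    (fun t => ((hd (t + s₀)).comp_add_const t s₀).sub_const _) C
    (fun t => by
      have := Convex.norm_image_sub_le_of_norm_deriv_le (f := u) (s := univ) (x := s₀) (y := t + s₀) (C := C)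
        (fun x _ => (hd x).differentiableAt) (fun x _ => hC x) convex_univ (mem_univ _) (mem_univ _)
      simpa using this)
    (idu.comp_add_right s₀)
  have e1 : ∫ s, |u s - u s₀| ^ p / |s₀ - s| ^ p = ∫ t, |u (t + s₀) - u s₀| ^ p / |t| ^ p := by
    rw [← integral_add_right_eq_self _ s₀]
    congr 1; ext t
    rw [show s₀ - (t + s₀) = -t by ring, abs_neg]
  rw [integral_add_right_eq_self (fun t => |deriv u t| ^ p) s₀] at hh
  rw [e1, mul_assoc]
  exact (mul_le_mul_of_nonneg_left hh (cP_nonneg hp2)).trans hmain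

lemma integral_radial (n : ℕ) (hn : 3 ≤ n) : ∃ C : ℝ, 0 ≤ C ∧ ∀ Φ : ℝ → ℝ,
    ∫ x : EuclideanSpace ℝ (Fin n), Φ ‖x‖ = C * ∫ s : ℝ, (Real.exp s) ^ n * Φ (Real.exp s) := by
  have : Nonempty (Fin n) := ⟨⟨0, by omega⟩⟩
  refine ⟨n * (volume : Measure (EuclideanSpace ℝ (Fin n))).real (Metric.ball 0 1), by positivity, ?_⟩
  intro Φ
  rw [integral_fun_norm_addHaar volume Φ]
  have h := integral_image_eq_integral_abs_deriv_smul (s := univ) (f := Real.exp) (f' := Real.exp)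
    MeasurableSet.univ (fun x _ => (Real.hasDerivAt_exp x).hasDerivWithinAt) Real.exp_injective.injOn
    (fun y => y ^ (n - 1) • Φ y)
  rw [image_univ, Real.range_exp, setIntegral_univ] at h
  simp only [finrank_euclideanSpace, Fintype.card_fin, nsmul_eq_mul, smul_eq_mul] at h ⊢
  rw [h, mul_assoc]
  congr 3
  ext s
  rw [abs_of_pos (Real.exp_pos s), ← mul_assoc, ← pow_succ', Nat.sub_add_cancel (by omega)]

theorem stmt_18 (n : ℕ) (hn : 3 ≤ n) (p α : ℝ) (hp2 : 2 ≤ p) (hpn : p < n)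
    (hα : α < ((n : ℝ) - p) / p)
    (f : EuclideanSpace ℝ (Fin n) → ℝ) (hf : ContDiff ℝ (⊤ : ℕ∞) f) (hsupp : HasCompactSupport f)
    (h0 : ∃ ε > (0 : ℝ), ∀ x : EuclideanSpace ℝ (Fin n), ‖x‖ < ε → f x = 0)
    (ftilde : ℝ → ℝ) (hrad : ∀ x : EuclideanSpace ℝ (Fin n), f x = ftilde ‖x‖) :
    (∫ x : EuclideanSpace ℝ (Fin n), ‖fderiv ℝ f x‖ ^ p / ‖x‖ ^ (α * p)) -
        (((n : ℝ) - p - α * p) / p) ^ p *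
          ∫ x : EuclideanSpace ℝ (Fin n), |f x| ^ p / ‖x‖ ^ ((α + 1) * p) ≥
      sInf ((fun t : ℝ => (1 - t) ^ p - t ^ p + p * t ^ (p - 1)) '' Ioc (0 : ℝ) (1 / 2)) *
        ((p - 1) / p) ^ p *
        ⨆ R : ℝ, ⨆ _ : 0 < R,
          ∫ x : EuclideanSpace ℝ (Fin n),
            |f x - (R ^ (((n : ℝ) - p - α * p) / p) * ftilde R) *
                ‖x‖ ^ (-(((n : ℝ) - p - α * p) / p))| ^ p /
              (|Real.log (R / ‖x‖)| ^ p * ‖x‖ ^ ((α + 1) * p)) := by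
  have hp0 : 0 < p := by linarith
  set q := ((n : ℝ) - p - α * p) / p with hqdef
  have hqp : q * p = n - p - α * p := by rw [hqdef]; field_simp
  have hq : 0 ≤ q := by
    rw [lt_div_iff₀ hp0] at hα
    exact div_nonneg (by linarith) hp0.le
  have : Nonempty (Fin n) := ⟨⟨0, by omega⟩⟩
  obtain ⟨e, he⟩ : ∃ e : EuclideanSpace ℝ (Fin n), ‖e‖ = 1 := exists_norm_eq _ zero_le_one
  set F : ℝ → ℝ := fun r => f (r • e) with hF
  have hFft : ∀ r, 0 ≤ r → F r = ftilde r := fun r hr => by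
    simp only [hF, hrad, norm_smul, he, mul_one, Real.norm_of_nonneg hr]
  have hfF : ∀ x, f x = F ‖x‖ := fun x => by rw [hFft _ (norm_nonneg _), hrad]
  have hFs : ContDiff ℝ (⊤ : ℕ∞) F := hf.comp (contDiff_id.smul contDiff_const)
  have hFd : Differentiable ℝ F := hFs.differentiable (by simp)
  obtain ⟨ε, hε, hεf⟩ := h0
  have hF0 : ∀ r, |r| < ε → F r = 0 := fun r hr => hεf _ (by simpa [norm_smul, he] using hr)
  obtain ⟨M, hM⟩ : ∃ M, ∀ r, M < r → F r = 0 := by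
    obtain ⟨M, hM⟩ := hsupp.isCompact.isBounded.exists_norm_le
    refine ⟨M, fun r hr => ?_⟩
    by_contra hne
    have := hM _ (subset_tsupport f hne)
    rw [norm_smul, he, mul_one] at this
    linarith [le_abs_self r, Real.norm_eq_abs r]
  -- the gradient
  have hgrad : ∀ x : EuclideanSpace ℝ (Fin n), ‖fderiv ℝ f x‖ = |deriv F ‖x‖| := by
    intro x
    by_cases hx : x = 0
    · subst hx
      have h1 : f =ᶠ[nhds 0] fun _ => 0 := by
        filter_upwards [Metric.ball_mem_nhds (0 : EuclideanSpace ℝ (Fin n)) hε] with y hy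
        exact hεf y (by simpa using hy)
      have h2 : F =ᶠ[nhds 0] fun _ => 0 := by
        filter_upwards [Metric.ball_mem_nhds (0 : ℝ) hε] with y hy
        exact hF0 y (by simpa using hy)
      rw [norm_zero, h1.fderiv_eq, h2.deriv_eq]
      simp
    · have hn1 : DifferentiableAt ℝ (fun y : EuclideanSpace ℝ (Fin n) => ‖y‖) x :=
        (contDiffAt_norm ℝ hx (n := 1)).differentiableAt (by norm_num)
      have h1 := (hFd ‖x‖).hasDerivAt.comp_hasFDerivAt x hn1.hasFDerivAt
      have h2 : f = F ∘ fun y => ‖y‖ := funext hfF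
      rw [h2, h1.fderiv, norm_smul, norm_fderiv_norm hn1, mul_one, Real.norm_eq_abs]
  -- the one dimensional function
  set u : ℝ → ℝ := fun s => Real.exp (q * s) * F (Real.exp s) with hu
  have hus : ContDiff ℝ 1 u := by
    have : ContDiff ℝ 1 F := hFs.of_le (by exact_mod_cast le_top)
    have h2 : ContDiff ℝ 1 (fun s => F (Real.exp s)) := this.comp Real.contDiff_exp
    exact (Real.contDiff_exp.comp (contDiff_const.mul contDiff_id)).mul h2
  have huc : HasCompactSupport u := by
    apply HasCompactSupport.intro (isCompact_Icc (a := Real.log ε) (b := Real.log (max M 1)))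
    intro s hs
    have : F (Real.exp s) = 0 := by
      by_contra hne
      apply hs
      constructor
      · rw [Real.log_le_iff_le_exp hε]
        by_contra hlt
        exact hne (hF0 _ (by rw [abs_of_pos (Real.exp_pos s)]; exact not_le.1 hlt))
      · rw [Real.le_log_iff_exp_le (by positivity)]
        by_contra hlt
        exact hne (hM _ (lt_of_le_of_lt (le_max_left _ _) (not_le.1 hlt)))
    simp only [hu, this, mul_zero]
  have hud : ∀ s, deriv u s - q * u s = Real.exp ((q + 1) * s) * deriv F (Real.exp s) := by
    intro s
    have h1 : HasDerivAt (fun s => Real.exp (q * s)) (Real.exp (q * s) * q) s := by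
      simpa using ((hasDerivAt_id s).const_mul q).exp
    have h2 : HasDerivAt (fun s => F (Real.exp s)) (deriv F (Real.exp s) * Real.exp s) s :=
      (hFd _).hasDerivAt.comp s (Real.hasDerivAt_exp s)
    have h3 : deriv u s = _ := (h1.mul h2).deriv
    rw [h3, add_mul, Real.exp_add, one_mul]
    simp only [hu]
    ring
  obtain ⟨C, hC0, hC⟩ := integral_radial n hn
  have hpow : ∀ s : ℝ, Real.exp s ^ n = Real.exp (n * s) := fun s => (Real.exp_nat_mul s n).symm
  have hrp : ∀ s c : ℝ, Real.exp s ^ c = Real.exp (s * c) := fun s c => (Real.exp_mul s c).symm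
  have I1 : (∫ x : EuclideanSpace ℝ (Fin n), ‖fderiv ℝ f x‖ ^ p / ‖x‖ ^ (α * p)) =
      C * ∫ s, |deriv u s - q * u s| ^ p := by
    simp only [hgrad]
    rw [hC (fun r => |deriv F r| ^ p / r ^ (α * p))]
    congr 2; ext s
    rw [hud, abs_mul, Real.mul_rpow (abs_nonneg _) (abs_nonneg _), Real.abs_exp, hpow, hrp, hrp,
      div_eq_mul_inv, ← Real.exp_neg, mul_left_comm, ← Real.exp_add, mul_comm]
    congr 2
    linear_combination (-s) * hqp
  have I2 : (∫ x : EuclideanSpace ℝ (Fin n), |f x| ^ p / ‖x‖ ^ ((α + 1) * p)) =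
      C * ∫ s, |u s| ^ p := by
    simp only [hfF]
    rw [hC (fun r => |F r| ^ p / r ^ ((α + 1) * p))]
    congr 2; ext s
    simp only [hu]
    rw [abs_mul, Real.mul_rpow (abs_nonneg _) (abs_nonneg _), Real.abs_exp, hpow, hrp, hrp,
      div_eq_mul_inv, ← Real.exp_neg, mul_left_comm, ← Real.exp_add, mul_comm]
    congr 2
    linear_combination (-s) * hqp
  have I3 : ∀ R : ℝ, 0 < R → (∫ x : EuclideanSpace ℝ (Fin n),
            |f x - (R ^ q * ftilde R) * ‖x‖ ^ (-q)| ^ p /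
              (|Real.log (R / ‖x‖)| ^ p * ‖x‖ ^ ((α + 1) * p))) =
      C * ∫ s, |u s - u (Real.log R)| ^ p / |Real.log R - s| ^ p := by
    intro R hR
    simp only [hfF]
    rw [hC (fun r => |F r - (R ^ q * ftilde R) * r ^ (-q)| ^ p /
              (|Real.log (R / r)| ^ p * r ^ ((α + 1) * p)))]
    congr 2; ext s
    have e1 : u (Real.log R) = R ^ q * ftilde R := by
      simp only [hu]
      rw [Real.exp_log hR, hFft R hR.le, Real.rpow_def_of_pos hR, mul_comm q]
    have e2 : F (Real.exp s) - (R ^ q * ftilde R) * Real.exp s ^ (-q) =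
        Real.exp (-(q * s)) * (u s - u (Real.log R)) := by
      rw [e1, hrp, mul_sub]
      simp only [hu]
      rw [← mul_assoc, ← Real.exp_add]
      simp only [neg_add_cancel, Real.exp_zero]
      ring_nf
    rw [e2, Real.log_div hR.ne' (Real.exp_ne_zero _), Real.log_exp, abs_mul,
      Real.mul_rpow (abs_nonneg _) (abs_nonneg _), Real.abs_exp, hpow, hrp, hrp]
    have e3 : Real.exp (n * s) * Real.exp (-(q * s) * p) = Real.exp (s * ((α + 1) * p)) := by
      rw [← Real.exp_add]; congr 1
      linear_combination (-s) * hqp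
    rw [← mul_div_assoc, ← mul_assoc, e3, mul_comm (|Real.log R - s| ^ p), mul_div_mul_left _ _ (Real.exp_ne_zero _)]
  rw [I1, I2]
  have hcp : 0 ≤ cP p := cP_nonneg hp2
  have hk : 0 < ((p - 1) / p) ^ p := Real.rpow_pos_of_pos (div_pos (by linarith) hp0) p
  change cP p * _ * _ ≤ _
  set A := cP p * ((p - 1) / p) ^ p with hA
  have hA0 : 0 ≤ A := mul_nonneg hcp hk.le
  set D := (C * ∫ s, |deriv u s - q * u s| ^ p) - q ^ p * (C * ∫ s, |u s| ^ p) with hD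
  have hbound : ∀ R : ℝ, 0 < R → A * (C * ∫ s, |u s - u (Real.log R)| ^ p / |Real.log R - s| ^ p) ≤ D := by
    intro R hR
    have := mul_le_mul_of_nonneg_left (core hp2 q hq u hus huc (Real.log R)) hC0
    rw [hD]
    linarith
  have hD0 : 0 ≤ D := by
    refine le_trans ?_ (hbound 1 one_pos)
    have : 0 ≤ ∫ s, |u s - u (Real.log 1)| ^ p / |Real.log 1 - s| ^ p :=
      integral_nonneg fun s => by positivity
    positivity
  rw [Real.mul_iSup_of_nonneg hA0]
  refine Real.iSup_le (fun R => ?_) hD0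
  rw [Real.mul_iSup_of_nonneg hA0]
  refine Real.iSup_le (fun hR => ?_) hD0
  rw [I3 R hR]
  exact hbound R hR
end
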